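/- Let β ∈ (0,1), μ > 0, t > 0, κ_0 ∈ (0,1), α > κ_0/2, and let L : (0,∞) → (0,∞) be a measurable function that is slowly varying at infinity (i.e., L(ux)/L(x) → 1 as x → ∞ for every u > 0) and bounded on every finite interval. Then lim_{ε→0⁺} ∫_0^∞ E_β²(−μ λ^α t^β) λ^{κ_0−1} |1 − L(1/(λε))/L(1/ε)| dλ = 0. -/

import Mathlib

open Real Filter Topology MeasureTheory

/-- The Mittag-Leffler function `E_β(s) = ∑_{k=0}^∞ s^k / Γ(1 + βk)`. -/
noncomputable def mittagLeffler (β s : ℝ) : ℝ := ∑' k : ℕ, s ^ k / Real.Gamma (1 + β * k)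

lemma gamma_ratio {β x : ℝ} (h0 : 0 < β) (h1 : β < 1) (hx : 0 < x) :
    x * Real.Gamma x ≤ Real.Gamma (x + β) * (x + β) ^ (1 - β) := by
  have h := Real.Gamma_mul_add_mul_le_rpow_Gamma_mul_rpow_Gamma (s := x + β) (t := x + β + 1)
    (a := β) (b := 1 - β) (by linarith) (by linarith) h0 (by linarith) (by ring)
  have e : β * (x + β) + (1 - β) * (x + β + 1) = x + 1 := by ring
  rw [e, Real.Gamma_add_one hx.ne', Real.Gamma_add_one (by linarith : x + β ≠ 0)] at h
  have hG : 0 < Real.Gamma (x + β) := Real.Gamma_pos_of_pos (by linarith)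
  rw [Real.mul_rpow (by linarith) hG.le] at h
  calc _ ≤ _ := h
    _ = (Real.Gamma (x + β) ^ β * Real.Gamma (x + β) ^ (1 - β)) * (x + β) ^ (1 - β) := by ring
    _ = _ := by rw [← Real.rpow_add hG]; simp

lemma ml_summable {β : ℝ} (h0 : 0 < β) (h1 : β < 1) (s : ℝ) :
    Summable (fun k : ℕ => s ^ k / Real.Gamma (1 + β * k)) := by
  have hlim : Tendsto (fun k : ℕ => (1 + β * (k : ℝ) + β) ^ (β)) atTop atTop := by
    refine (tendsto_rpow_atTop h0).comp ?_
    refine tendsto_atTop_add_const_right _ _ (tendsto_atTop_add_const_left _ _ ?_)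
    exact tendsto_natCast_atTop_atTop.const_mul_atTop h0
  refine summable_of_ratio_norm_eventually_le (r := 1/2) (by norm_num) ?_
  filter_upwards [hlim.eventually_ge_atTop (4 * |s|)] with k hk
  have hy : 1 ≤ 1 + β * (k : ℝ) := by have := mul_nonneg h0.le (Nat.cast_nonneg (α := ℝ) k); linarith
  set y := 1 + β * (k : ℝ) with hydef
  have e : 1 + β * ((k + 1 : ℕ) : ℝ) = y + β := by rw [hydef]; push_cast; ring
  have hG : 0 < Real.Gamma (y + β) := Real.Gamma_pos_of_pos (by linarith)
  have hG' : 0 < Real.Gamma y := Real.Gamma_pos_of_pos (by linarith)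
  have hr := gamma_ratio h0 h1 (show 0 < y by linarith)
  rw [e, norm_div, norm_div, norm_pow, norm_pow, Real.norm_eq_abs, Real.norm_eq_abs, Real.norm_eq_abs, abs_of_pos hG, abs_of_pos hG', pow_succ]
  have hp : (y + β) ^ β * (y + β) ^ (1 - β) = y + β := by
    rw [← Real.rpow_add (by linarith)]; simp
  have hpp : 0 < (y + β) ^ (1 - β) := Real.rpow_pos_of_pos (by linarith) _
  have key : 2 * |s| * Real.Gamma y ≤ Real.Gamma (y + β) := by
    have : 4 * |s| * (y+β)^(1-β) ≤ y + β := by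
      refine le_trans ?_ hp.le; gcongr
    have h2 : 4 * |s| * (y+β)^(1-β) ≤ 2 * y := by linarith
    have : 2 * |s| * Real.Gamma y * (y+β)^(1-β) ≤ Real.Gamma (y + β) * (y+β)^(1-β) := by nlinarith
    exact le_of_mul_le_mul_right this hpp
  rw [div_le_iff₀ hG]
  have : (1/2) * (|s|^k / Real.Gamma y) * Real.Gamma (y+β) ≥ (1/2) * (|s|^k / Real.Gamma y) * (2 * |s| * Real.Gamma y) := by
    gcongr
  refine le_trans (le_of_eq ?_) this
  field_simp

lemma ml_continuous {β : ℝ} (h0 : 0 < β) (h1 : β < 1) : Continuous (mittagLeffler β) := by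
  rw [continuous_iff_continuousAt]
  intro x
  have : ContinuousOn (mittagLeffler β) (Set.Ioo (-(|x|+1)) (|x|+1)) := by
    refine continuousOn_tsum (u := fun k : ℕ => (|x|+1)^k / Real.Gamma (1 + β * k)) ?_ (ml_summable h0 h1 _) ?_
    · intro i; fun_prop
    · intro n y hy
      have hG : 0 < Real.Gamma (1 + β * n) := Real.Gamma_pos_of_pos (by positivity)
      rw [norm_div, norm_pow, Real.norm_eq_abs, Real.norm_eq_abs, abs_of_pos hG]
      have : |y| ≤ |x| + 1 := by rw [abs_le]; constructor <;> linarith [hy.1, hy.2]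
      gcongr
  refine this.continuousAt (Ioo_mem_nhds ?_ ?_)
  · linarith [neg_abs_le x]
  · linarith [le_abs_self x]

lemma ml_zero {β : ℝ} : mittagLeffler β 0 = 1 := by
  unfold mittagLeffler
  rw [tsum_eq_single 0]
  · simp
  · intro k hk; simp [hk]

lemma beta_integral_real {a b : ℝ} (ha : 0 < a) (hb : 0 < b) :
    IntegrableOn (fun x : ℝ => x ^ (a - 1) * (1 - x) ^ (b - 1)) (Set.Ioo 0 1) ∧
    ∫ x in Set.Ioo (0:ℝ) 1, x ^ (a - 1) * (1 - x) ^ (b - 1)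
      = Real.Gamma a * Real.Gamma b / Real.Gamma (a + b) := by
  have hc : IntegrableOn (fun x : ℝ => (x:ℂ) ^ ((a:ℂ) - 1) * (1 - (x:ℂ)) ^ ((b:ℂ) - 1)) (Set.Ioo 0 1) := by
    have := Complex.betaIntegral_convergent (u := a) (v := b) (by simpa) (by simpa)
    rw [intervalIntegrable_iff_integrableOn_Ioo_of_le (by simp)] at this
    exact this
  have heq : ∀ x ∈ Set.Ioo (0:ℝ) 1, RCLike.re ((x:ℂ) ^ ((a:ℂ) - 1) * (1 - (x:ℂ)) ^ ((b:ℂ) - 1))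
      = x ^ (a - 1) * (1 - x) ^ (b - 1) := by
    intro x hx
    norm_cast
    rw [← Complex.ofReal_cpow, ← Complex.ofReal_cpow, RCLike.re_to_complex,
        Complex.re_mul_ofReal, Complex.ofReal_re]
    all_goals linarith [hx.1, hx.2]
  constructor
  · exact IntegrableOn.congr_fun (f := fun x : ℝ => RCLike.re ((x:ℂ) ^ ((a:ℂ) - 1) * (1 - (x:ℂ)) ^ ((b:ℂ) - 1))) (Integrable.re hc) heq measurableSet_Ioo
  · have := ProbabilityTheory.beta_eq_betaIntegralReal a b ha hb
    rw [ProbabilityTheory.beta] at this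
    rw [this, Complex.betaIntegral, intervalIntegral.integral_of_le (by norm_num),
      integral_Ioc_eq_integral_Ioo, ← RCLike.re_to_complex, ← integral_re hc]
    exact (setIntegral_congr_fun measurableSet_Ioo heq).symm

lemma one_sub_rpow_le {p u : ℝ} (hp : 0 < p) (h0 : 0 < u) (h1 : u < 1) :
    1 - u ^ p ≤ (p + 1) * (1 - u) := by
  rcases le_total 1 p with h | h
  · have := one_add_mul_self_le_rpow_one_add (s := u - 1) (by linarith) h
    rw [show 1 + (u - 1) = u by ring] at this
    nlinarith
  · have : u ^ (1:ℝ) ≤ u ^ p := Real.rpow_le_rpow_of_exponent_ge h0 h1.le h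
    rw [Real.rpow_one] at this
    nlinarith

lemma int_one_sub {b : ℝ} (h1 : b < 1) :
    IntegrableOn (fun u : ℝ => (1 - u) ^ (-b)) (Set.Ioo 0 1) ∧
      ∫ u in Set.Ioo (0:ℝ) 1, (1 - u) ^ (-b) = 1 / (1 - b) := by
  have h := beta_integral_real (a := 1) (b := 1 - b) (by norm_num) (by linarith)
  have e : (fun x : ℝ => x ^ ((1:ℝ) - 1) * (1 - x) ^ (1 - b - 1)) = fun u : ℝ => (1 - u) ^ (-b) := by
    funext x; simp
  rw [e] at h
  refine ⟨h.1, h.2.trans ?_⟩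
  have hG := (Real.Gamma_pos_of_pos (show 0 < 1 - b by linarith)).ne'
  rw [show 1 + (1 - b) = (1 - b) + 1 by ring, Real.Gamma_add_one (by linarith : 1 - b ≠ 0), Real.Gamma_one]
  have : 1 - b ≠ 0 := by linarith
  field_simp

lemma J_int {β p : ℝ} (h1 : β < 1) (hp : 0 < p) :
    IntegrableOn (fun u : ℝ => (1 - u ^ p) * (1 - u) ^ (-β - 1)) (Set.Ioo 0 1) := by
  refine Integrable.mono' ((int_one_sub h1).1.const_mul (p + 1)) ?_ ?_
  · exact Measurable.aestronglyMeasurable (by fun_prop)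
  · refine ae_restrict_of_forall_mem measurableSet_Ioo (fun u hu => ?_)
    have h2 : 0 < 1 - u := by linarith [hu.2]
    have h3 : u ^ p ≤ 1 := Real.rpow_le_one hu.1.le hu.2.le hp.le
    have h4 := one_sub_rpow_le hp hu.1 hu.2
    have h5 : (1 - u) ^ (-β) = (1 - u) * (1 - u) ^ (-β - 1) := by
      rw [mul_comm, ← Real.rpow_add_one h2.ne']; congr 1; ring
    rw [Real.norm_eq_abs, abs_of_nonneg (mul_nonneg (by linarith) (Real.rpow_nonneg h2.le _)), h5,
      ← mul_assoc]
    exact mul_le_mul_of_nonneg_right h4 (Real.rpow_nonneg h2.le _)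

lemma J_val {β p : ℝ} (h1 : β < 1) (hp : 0 < p) :
    β * ∫ u in Set.Ioo (0:ℝ) 1, (1 - u ^ p) * (1 - u) ^ (-β - 1)
      = Real.Gamma (1 - β) * Real.Gamma (1 + p) / Real.Gamma (1 + p - β) - 1 := by
  have hB := beta_integral_real (a := p) (b := 1 - β) hp (by linarith)
  have hJ := J_int h1 hp
  rw [show 1 - β - 1 = -β by ring] at hB
  have hd : ∀ u ∈ Set.Ioo (0:ℝ) 1, HasDerivAt (fun u : ℝ => (1 - u ^ p) * (1 - u) ^ (-β))
      (β * ((1 - u ^ p) * (1 - u) ^ (-β - 1)) - p * (u ^ (p - 1) * (1 - u) ^ (-β))) u := by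
    intro u hu
    have h2 : 0 < 1 - u := by linarith [hu.2]
    have d1 : HasDerivAt (fun u : ℝ => 1 - u ^ p) (-(p * u ^ (p - 1))) u :=
      (Real.hasDerivAt_rpow_const (Or.inl hu.1.ne')).const_sub 1
    have d2 : HasDerivAt (fun u : ℝ => (1 - u) ^ (-β)) ((-1) * (-β) * (1 - u) ^ (-β - 1)) u :=
      ((hasDerivAt_id u).const_sub 1).rpow_const (Or.inl h2.ne')
    exact (d1.mul d2).congr_deriv (by ring)
  have hintg : IntervalIntegrable (fun u : ℝ => β * ((1 - u ^ p) * (1 - u) ^ (-β - 1)) - p * (u ^ (p - 1) * (1 - u) ^ (-β))) volume 0 1 := by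
    rw [intervalIntegrable_iff_integrableOn_Ioo_of_le (by simp)]
    exact (hJ.const_mul β).sub (hB.1.const_mul p)
  have ha : Tendsto (fun u : ℝ => (1 - u ^ p) * (1 - u) ^ (-β)) (𝓝[>] 0) (𝓝 1) := by
    have : ContinuousAt (fun u : ℝ => (1 - u ^ p) * (1 - u) ^ (-β)) 0 := by
      refine ContinuousAt.mul ?_ ?_
      · exact continuousAt_const.sub (Real.continuousAt_rpow_const _ _ (Or.inr hp.le))
      · exact ContinuousAt.rpow_const (by fun_prop) (Or.inl (by norm_num))
    have h := this.tendsto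
    simp only [Real.zero_rpow hp.ne', sub_zero, Real.one_rpow, mul_one] at h
    exact h.mono_left nhdsWithin_le_nhds
  have hb : Tendsto (fun u : ℝ => (1 - u ^ p) * (1 - u) ^ (-β)) (𝓝[<] 1) (𝓝 0) := by
    have hz : Tendsto (fun u : ℝ => (p + 1) * (1 - u) ^ (1 - β)) (𝓝[<] 1) (𝓝 0) := by
      have : ContinuousAt (fun u : ℝ => (p + 1) * (1 - u) ^ (1 - β)) 1 :=
        continuousAt_const.mul (ContinuousAt.rpow_const (by fun_prop) (Or.inr (by linarith)))
      have h := this.tendsto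
      simp only [sub_self, Real.zero_rpow (by linarith : 1 - β ≠ 0), mul_zero] at h
      exact h.mono_left nhdsWithin_le_nhds
    have hmem : Set.Ioo (0:ℝ) 1 ∈ 𝓝[<] (1:ℝ) := Ioo_mem_nhdsLT (by norm_num)
    refine tendsto_of_tendsto_of_tendsto_of_le_of_le' tendsto_const_nhds hz ?_ ?_
    · filter_upwards [hmem] with u hu
      exact mul_nonneg (by linarith [Real.rpow_le_one hu.1.le hu.2.le hp.le]) (Real.rpow_nonneg (by linarith [hu.2]) _)
    · filter_upwards [hmem] with u hu
      have h2 : 0 < 1 - u := by linarith [hu.2]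
      have h5 : (1 - u) ^ (1 - β) = (1 - u) * (1 - u) ^ (-β) := by
        rw [mul_comm, ← Real.rpow_add_one h2.ne']; congr 1; ring
      rw [h5, ← mul_assoc]
      exact mul_le_mul_of_nonneg_right (one_sub_rpow_le hp hu.1 hu.2) (Real.rpow_nonneg h2.le _)
  have H := intervalIntegral.integral_eq_sub_of_hasDerivAt_of_tendsto (by norm_num) hd hintg ha hb
  rw [intervalIntegral.integral_of_le (by norm_num), integral_Ioc_eq_integral_Ioo,
    integral_sub (hJ.const_mul β) (hB.1.const_mul p), integral_const_mul, integral_const_mul, hB.2] at H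
  rw [show 1 + p = p + 1 by ring, Real.Gamma_add_one hp.ne', show p + 1 - β = p + (1 - β) by ring]
  have : β * ∫ u in Set.Ioo (0:ℝ) 1, (1 - u ^ p) * (1 - u) ^ (-β - 1) = p * (Gamma p * Gamma (1 - β) / Gamma (p + (1 - β))) - 1 := by linarith
  rw [this]; ring

/-- The Marchaud-type identity. -/
lemma ml_identity {β : ℝ} (h0 : 0 < β) (h1 : β < 1) {x : ℝ} (hx : 0 ≤ x) :
    β * ∫ u in Set.Ioo (0:ℝ) 1, (mittagLeffler β (-(x * u ^ β)) - mittagLeffler β (-x)) * (1 - u) ^ (-β - 1)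
      = (1 + Real.Gamma (1 - β) * x) * mittagLeffler β (-x) - 1 := by
  set c : ℕ → ℝ := fun k => (-x) ^ (k + 1) / Real.Gamma (1 + β * (k + 1 : ℕ)) with hc
  set F : ℕ → ℝ → ℝ := fun k u => -c k * ((1 - u ^ (β * (k + 1 : ℕ))) * (1 - u) ^ (-β - 1)) with hF
  have hpk : ∀ k : ℕ, 0 < β * (k + 1 : ℕ) := fun k => mul_pos h0 (by exact_mod_cast Nat.succ_pos k)
  have hS : ∀ s : ℝ, HasSum (fun k : ℕ => s ^ (k + 1) / Real.Gamma (1 + β * (k + 1 : ℕ))) (mittagLeffler β s - 1) := by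
    intro s
    have h := (ml_summable h0 h1 s).hasSum
    have := (hasSum_nat_add_iff' 1).2 h
    simpa [mittagLeffler] using this
  have hval : ∀ k, β * ∫ u in Set.Ioo (0:ℝ) 1, (1 - u ^ (β * (k + 1 : ℕ))) * (1 - u) ^ (-β - 1)
      = Real.Gamma (1 - β) * Real.Gamma (1 + β * (k + 1 : ℕ)) / Real.Gamma (1 + β * k) - 1 := by
    intro k
    rw [J_val h1 (hpk k)]
    congr 3
    push_cast; ring
  have hGp : ∀ k : ℕ, 0 < Real.Gamma (1 + β * k) := fun k => Real.Gamma_pos_of_pos (by positivity)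
  have hI : ∀ k, Integrable (F k) (volume.restrict (Set.Ioo 0 1)) := fun k =>
    (J_int h1 (hpk k)).const_mul _
  have hcv : ∀ k, β * ∫ u in Set.Ioo (0:ℝ) 1, F k u = Gamma (1 - β) * x * ((-x) ^ k / Gamma (1 + β * k)) + c k := by
    intro k
    simp only [hF]
    rw [integral_const_mul, mul_left_comm, hval k]
    have a1 := (hGp k).ne'
    have a2 := (hGp (k+1)).ne'
    simp only [hc]
    field_simp
    ring
  have hsum : Summable fun k => ∫ u in Set.Ioo (0:ℝ) 1, ‖F k u‖ := by
    have e : ∀ k, ∫ u in Set.Ioo (0:ℝ) 1, ‖F k u‖ = β⁻¹ * (Gamma (1 - β) * x * (x ^ k / Gamma (1 + β * k)) - x ^ (k + 1) / Real.Gamma (1 + β * (k + 1 : ℕ))) := by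
      intro k
      have : ∫ u in Set.Ioo (0:ℝ) 1, ‖F k u‖ = |c k| * ∫ u in Set.Ioo (0:ℝ) 1, (1 - u ^ (β * (k + 1 : ℕ))) * (1 - u) ^ (-β - 1) := by
        rw [← integral_const_mul]
        refine setIntegral_congr_fun measurableSet_Ioo (fun u hu => ?_)
        have : 0 ≤ (1 - u ^ (β * (k + 1 : ℕ))) * (1 - u) ^ (-β - 1) :=
          mul_nonneg (by linarith [Real.rpow_le_one hu.1.le hu.2.le (hpk k).le]) (Real.rpow_nonneg (by linarith [hu.2]) _)
        simp only [hF]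
        rw [norm_mul, norm_neg, Real.norm_eq_abs, Real.norm_eq_abs, abs_of_nonneg this]
      have h2 : ∫ u in Set.Ioo (0:ℝ) 1, (1 - u ^ (β * (k + 1 : ℕ))) * (1 - u) ^ (-β - 1) = β⁻¹ * (Real.Gamma (1 - β) * Real.Gamma (1 + β * (k + 1 : ℕ)) / Real.Gamma (1 + β * k) - 1) := by
        rw [← hval k]; field_simp
      rw [this, h2]
      have a1 := (hGp k).ne'
      have a2 := (hGp (k+1)).ne'
      have : |c k| = x ^ (k + 1) / Real.Gamma (1 + β * (k + 1 : ℕ)) := by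
        simp only [hc]
        rw [abs_div, abs_pow, abs_neg, abs_of_nonneg hx, abs_of_pos (hGp (k+1))]
      rw [this]
      field_simp
      ring
    simp_rw [e]
    exact (((ml_summable h0 h1 x).mul_left _).sub (hS x).summable).mul_left _
  have H := hasSum_integral_of_summable_integral_norm hI hsum
  have H2 := H.mul_left β
  simp_rw [hcv] at H2
  have H3 : HasSum (fun k : ℕ => Gamma (1 - β) * x * ((-x) ^ k / Gamma (1 + β * k)) + c k)
      (Gamma (1 - β) * x * mittagLeffler β (-x) + (mittagLeffler β (-x) - 1)) :=
    ((ml_summable h0 h1 (-x)).hasSum.mul_left _).add (hS (-x))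
  have H4 := H2.unique H3
  have e : ∫ u in Set.Ioo (0:ℝ) 1, (mittagLeffler β (-(x * u ^ β)) - mittagLeffler β (-x)) * (1 - u) ^ (-β - 1)
      = ∫ u in Set.Ioo (0:ℝ) 1, ∑' k, F k u := by
    refine setIntegral_congr_fun measurableSet_Ioo (fun u hu => ?_)
    have hh := ((hS (-(x * u ^ β))).sub (hS (-x))).mul_right ((1 - u) ^ (-β - 1))
    have hfe : (fun k : ℕ => ((-(x * u ^ β)) ^ (k + 1) / Real.Gamma (1 + β * (k + 1 : ℕ)) - (-x) ^ (k + 1) / Real.Gamma (1 + β * (k + 1 : ℕ))) * (1 - u) ^ (-β - 1)) = fun k => F k u := by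
      funext k
      simp only [hF, hc]
      rw [Real.rpow_mul hu.1.le, Real.rpow_natCast, ← neg_mul, mul_pow]
      ring
    rw [hfe] at hh
    rw [hh.tsum_eq]
    ring
  rw [e, H4]; ring

lemma setint_le {f g : ℝ → ℝ} {s : Set ℝ} (hs : MeasurableSet s) (hg : IntegrableOn g s)
    (hg0 : ∀ u ∈ s, 0 ≤ g u) (h : ∀ u ∈ s, f u ≤ g u) : ∫ u in s, f u ≤ ∫ u in s, g u := by
  by_cases hf : IntegrableOn f s
  · exact setIntegral_mono_on hf hg hs h
  · rw [integral_undef hf]; exact setIntegral_nonneg hs hg0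

lemma ml_sign {β : ℝ} (h0 : 0 < β) (h1 : β < 1) {x : ℝ} (hx : 0 ≤ x) {M : ℝ} (hM : 0 ≤ M)
    (h : ∀ u ∈ Set.Ioo (0:ℝ) 1, |mittagLeffler β (-(x * u ^ β))| - |mittagLeffler β (-x)| ≤ M * (1 - u)) :
    (1 + Real.Gamma (1 - β) * x) * |mittagLeffler β (-x)| ≤ 1 + β * (M / (1 - β)) := by
  have key : ∀ σ : ℝ, |σ| = 1 → σ * mittagLeffler β (-x) = |mittagLeffler β (-x)| →
      (1 + Real.Gamma (1 - β) * x) * |mittagLeffler β (-x)| ≤ 1 + β * (M / (1 - β)) := by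
    intro σ hσ hs
    have hid := congrArg (σ * ·) (ml_identity h0 h1 hx)
    rw [mul_left_comm, ← integral_const_mul] at hid
    have hle : ∫ u in Set.Ioo (0:ℝ) 1, σ * ((mittagLeffler β (-(x * u ^ β)) - mittagLeffler β (-x)) * (1 - u) ^ (-β - 1)) ≤ ∫ u in Set.Ioo (0:ℝ) 1, M * (1 - u) ^ (-β) := by
      refine setint_le measurableSet_Ioo ((int_one_sub h1).1.const_mul M) ?_ ?_
      · intro u hu; exact mul_nonneg hM (Real.rpow_nonneg (by linarith [hu.2]) _)
      · intro u hu
        have h2 : 0 < 1 - u := by linarith [hu.2]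
        have h5 : (1 - u) ^ (-β) = (1 - u) * (1 - u) ^ (-β - 1) := by
          rw [mul_comm, ← Real.rpow_add_one h2.ne']; congr 1; ring
        rw [h5, ← mul_assoc, ← mul_assoc]
        refine mul_le_mul_of_nonneg_right ?_ (Real.rpow_nonneg h2.le _)
        have := h u hu
        have h6 : σ * mittagLeffler β (-(x * u ^ β)) ≤ |mittagLeffler β (-(x * u ^ β))| := by
          refine (le_abs_self _).trans ?_
          rw [abs_mul, hσ, one_mul]
        rw [mul_sub, hs]; linarith
    rw [integral_const_mul M, (int_one_sub h1).2] at hle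
    have h7 := mul_le_mul_of_nonneg_left hle h0.le
    rw [hid] at h7
    have h8 : σ ≤ 1 := (le_abs_self _).trans hσ.le
    rw [← hs]
    have : M * (1 / (1 - β)) = M / (1 - β) := by ring
    rw [this] at h7
    nlinarith
  rcases le_total 0 (mittagLeffler β (-x)) with h | h
  · exact key 1 (by simp) (by rw [abs_of_nonneg h]; ring)
  · exact key (-1) (by simp) (by rw [abs_of_nonpos h]; ring)

lemma ml_le_one {β : ℝ} (h0 : 0 < β) (h1 : β < 1) {x : ℝ} (hx : 0 ≤ x) :
    |mittagLeffler β (-x)| ≤ 1 := by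
  have hcont : Continuous fun x => |mittagLeffler β (-x)| := ((ml_continuous h0 h1).comp continuous_neg).abs
  obtain ⟨y, hy, hmax⟩ := (isCompact_Icc (a := (0:ℝ)) (b := x)).exists_isMaxOn ⟨0, by simp [hx]⟩ hcont.continuousOn
  have hyb := ml_sign h0 h1 hy.1 (M := 0) le_rfl (by
    intro u hu
    have hu1 : u ^ β ≤ 1 := Real.rpow_le_one hu.1.le hu.2.le h0.le
    have hu0 : 0 ≤ u ^ β := Real.rpow_nonneg hu.1.le _
    have : |mittagLeffler β (-(y * u ^ β))| ≤ |mittagLeffler β (-y)| :=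
      hmax (show y * u ^ β ∈ Set.Icc 0 x from ⟨mul_nonneg hy.1 hu0, by nlinarith [hy.1, hy.2]⟩)
    linarith)
  have : |mittagLeffler β (-x)| ≤ |mittagLeffler β (-y)| := hmax (show x ∈ Set.Icc 0 x from ⟨hx, le_rfl⟩)
  have hG : 0 < Real.Gamma (1 - β) := Real.Gamma_pos_of_pos (by linarith)
  have := abs_nonneg (mittagLeffler β (-y))
  have := mul_nonneg (mul_nonneg hG.le hy.1) this
  simp at hyb
  nlinarith

lemma ml_decay {β : ℝ} (h0 : 0 < β) (h1 : β < 1) :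
    ∃ C : ℝ, 0 < C ∧ ∀ x : ℝ, 0 ≤ x → x * |mittagLeffler β (-x)| ≤ C := by
  have hG : 0 < Real.Gamma (1 - β) := Real.Gamma_pos_of_pos (by linarith)
  have hb : 0 < 1 - β := by linarith
  refine ⟨(1 + β * (2 / (1 - β))) / Real.Gamma (1 - β), by positivity, fun x hx => ?_⟩
  have hcont : Continuous fun x => x * |mittagLeffler β (-x)| :=
    continuous_id.mul ((ml_continuous h0 h1).comp continuous_neg).abs
  obtain ⟨y, hy, hmax⟩ := (isCompact_Icc (a := (0:ℝ)) (b := x)).exists_isMaxOn ⟨0, by simp [hx]⟩ hcont.continuousOn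
  have hx' : x * |mittagLeffler β (-x)| ≤ y * |mittagLeffler β (-y)| := hmax (show x ∈ Set.Icc 0 x from ⟨hx, le_rfl⟩)
  refine hx'.trans ?_
  rcases hy.1.eq_or_lt with hy0 | hy0
  · rw [← hy0]; simp; positivity
  have hyb := ml_sign h0 h1 hy.1 (M := 2) (by norm_num) (by
    intro u hu
    have hu1 : u ^ β ≤ 1 := Real.rpow_le_one hu.1.le hu.2.le h0.le
    have hu0 : 0 < u ^ β := Real.rpow_pos_of_pos hu.1 _
    have huu : u ≤ u ^ β := by
      have := Real.rpow_le_rpow_of_exponent_ge hu.1 hu.2.le h1.le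
      rwa [Real.rpow_one] at this
    have hA1 := ml_le_one h0 h1 (mul_nonneg hy.1 hu0.le)
    have hB1 := ml_le_one h0 h1 hy.1
    have hB0 := abs_nonneg (mittagLeffler β (-y))
    have hA0 := abs_nonneg (mittagLeffler β (-(y * u ^ β)))
    rcases le_total u (1/2) with h | h
    · nlinarith
    · have hm : y * u ^ β * |mittagLeffler β (-(y * u ^ β))| ≤ y * |mittagLeffler β (-y)| :=
        hmax (show y * u ^ β ∈ Set.Icc 0 x from ⟨mul_nonneg hy.1 hu0.le, by nlinarith [hy.1, hy.2]⟩)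
      have hm' : u ^ β * |mittagLeffler β (-(y * u ^ β))| ≤ |mittagLeffler β (-y)| := by
        rw [mul_assoc] at hm; exact le_of_mul_le_mul_left hm hy0
      have hm2 : u * |mittagLeffler β (-(y * u ^ β))| ≤ |mittagLeffler β (-y)| :=
        (mul_le_mul_of_nonneg_right huu hA0).trans hm'
      nlinarith [hu.2])
  rw [le_div_iff₀ hG]
  nlinarith [abs_nonneg (mittagLeffler β (-y))]

lemma min_tri (a b c : ℝ) : min |a - b| 1 ≤ min |c - a| 1 + min |c - b| 1 := by
  have h1 : |a - b| ≤ |c - a| + |c - b| := by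
    rw [abs_sub_comm c a]; exact abs_sub_le a c b
  have := abs_nonneg (c - a)
  have := abs_nonneg (c - b)
  rcases min_cases |c - a| 1 with ⟨h, _⟩ | ⟨h, _⟩ <;> rcases min_cases |c - b| 1 with ⟨h', _⟩ | ⟨h', _⟩ <;>
    rw [h, h']
  · exact (min_le_left _ _).trans h1
  all_goals exact (min_le_right _ _).trans (by linarith)

lemma uct (h : ℝ → ℝ) (hm : Measurable h)
    (hs : ∀ u : ℝ, Tendsto (fun x => h (x + u) - h x) atTop (𝓝 0)) {η : ℝ} (hη : 0 < η) :
    ∃ X : ℝ, ∀ x, X ≤ x → ∀ u ∈ Set.Icc (0:ℝ) 1, |h (x + u) - h x| ≤ η := by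
  have hintg : ∀ (y z a b : ℝ), IntervalIntegrable (fun v => min |h (y + v) - h z| 1) volume a b := by
    intro y z a b
    refine IntervalIntegrable.mono_fun' (g := fun _ => (1:ℝ)) (by simp) ?_ ?_
    · exact Measurable.aestronglyMeasurable (by fun_prop)
    · refine Eventually.of_forall (fun v => ?_)
      simp only
      rw [Real.norm_eq_abs, abs_of_nonneg (le_min (abs_nonneg _) zero_le_one)]
      exact min_le_right _ _
  have hD : Tendsto (fun x => ∫ v in (0:ℝ)..2, min |h (x + v) - h x| 1) atTop (𝓝 (∫ v in (0:ℝ)..2, (0:ℝ))) := by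
    refine intervalIntegral.tendsto_integral_filter_of_dominated_convergence (fun _ => (1:ℝ)) ?_ ?_ (by simp) ?_
    · exact Eventually.of_forall (fun x => Measurable.aestronglyMeasurable (by fun_prop))
    · refine Eventually.of_forall (fun x => Eventually.of_forall (fun v _ => ?_))
      rw [Real.norm_eq_abs, abs_of_nonneg (le_min (abs_nonneg _) zero_le_one)]
      exact min_le_right _ _
    · refine Eventually.of_forall (fun v _ => ?_)
      have := ((hs v).abs).min (tendsto_const_nhds (x := (1:ℝ)))
      simpa using this
  simp only [intervalIntegral.integral_zero] at hD
  set r := min η (1/2) with hr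
  have hr0 : 0 < r := lt_min hη (by norm_num)
  obtain ⟨X, hX⟩ := eventually_atTop.1 (hD.eventually_lt_const (show (0:ℝ) < r / 2 by linarith))
  refine ⟨X, fun x hx u hu => ?_⟩
  have hx1 := hX x hx
  have hx2 := hX (x + u) (by linarith [hu.1])
  have step : min |h (x + u) - h x| 1 ≤ (∫ v in (0:ℝ)..2, min |h (x + u + v) - h (x + u)| 1) + ∫ v in (0:ℝ)..2, min |h (x + v) - h x| 1 := by
    have e1 : min |h (x + u) - h x| 1 = ∫ w in (0:ℝ)..1, min |h (x + u) - h x| 1 := by simp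
    have e2 : (∫ w in (0:ℝ)..1, min |h (x + u) - h x| 1) ≤
        ∫ w in (0:ℝ)..1, (min |h (x + u + w) - h (x + u)| 1 + min |h (x + u + w) - h x| 1) := by
      refine intervalIntegral.integral_mono_on (by norm_num) (by simp) ((hintg _ _ _ _).add (hintg _ _ _ _)) ?_
      intro w _
      exact min_tri _ _ _
    rw [e1]
    refine e2.trans ?_
    rw [intervalIntegral.integral_add (hintg _ _ _ _) (hintg _ _ _ _)]
    have nn : ∀ y z : ℝ, ∀ μ : Measure ℝ, 0 ≤ᵐ[μ] fun v => min |h (y + v) - h z| 1 := fun y z μ =>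
      Eventually.of_forall fun v => le_min (abs_nonneg _) zero_le_one
    refine add_le_add ?_ ?_
    · exact intervalIntegral.integral_mono_interval le_rfl (by norm_num) (by norm_num) (nn _ _ _) (hintg _ _ _ _)
    · have e3 : ∫ w in (0:ℝ)..1, min |h (x + u + w) - h x| 1 = ∫ v in (u + 0)..(u + 1), min |h (x + v) - h x| 1 := by
        rw [← intervalIntegral.integral_comp_add_left]
        simp only [add_assoc]
      rw [e3]
      exact intervalIntegral.integral_mono_interval (by linarith [hu.1]) (by linarith) (by linarith [hu.2]) (nn _ _ _) (hintg _ _ _ _)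
  have hlt : min |h (x + u) - h x| 1 < r := by linarith
  have hr1 : r ≤ 1/2 := min_le_right _ _
  have hrη : r ≤ η := min_le_left _ _
  rcases min_lt_iff.1 hlt with h | h
  · linarith
  · linarith

lemma potter_log (h : ℝ → ℝ) (hm : Measurable h)
    (hs : ∀ u : ℝ, Tendsto (fun x => h (x + u) - h x) atTop (𝓝 0)) {η : ℝ} (hη : 0 < η) :
    ∃ X : ℝ, ∀ x y, X ≤ x → X ≤ y → |h y - h x| ≤ η * (|y - x| + 1) := by
  obtain ⟨X, hX⟩ := uct h hm hs hη
  have hn : ∀ n : ℕ, ∀ x, X ≤ x → |h (x + n) - h x| ≤ η * n := by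
    intro n
    induction n with
    | zero => intro x _; simp
    | succ n ih =>
      intro x hx
      have a := ih x hx
      have b := hX (x + n) (by linarith [Nat.cast_nonneg (α := ℝ) n]) 1 (by simp)
      have c := abs_sub_le (h (x + n + 1)) (h (x + n)) (h x)
      push_cast
      rw [← add_assoc]
      linarith
  have main : ∀ x y, X ≤ x → x ≤ y → |h y - h x| ≤ η * (|y - x| + 1) := by
    intro x y hx hxy
    set n := ⌊y - x⌋₊ with hndef
    have h1 : (n:ℝ) ≤ y - x := Nat.floor_le (by linarith)
    have h2 : y - x < n + 1 := Nat.lt_floor_add_one _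
    have a := hn n x hx
    have b := hX (x + n) (by linarith [Nat.cast_nonneg (α := ℝ) n]) (y - x - n) ⟨by linarith, by linarith⟩
    rw [show x + n + (y - x - n) = y by ring] at b
    have c := abs_sub_le (h y) (h (x + n)) (h x)
    rw [abs_of_nonneg (by linarith : 0 ≤ y - x)]
    nlinarith
  refine ⟨X, fun x y hx hy => ?_⟩
  rcases le_total x y with hxy | hxy
  · exact main x y hx hxy
  · rw [abs_sub_comm, abs_sub_comm y x]; exact main y x hy hxy

lemma potter (L : ℝ → ℝ) (hLmeas : Measurable L) (hLpos : ∀ x : ℝ, 0 < x → 0 < L x)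
    (hLslow : ∀ u : ℝ, 0 < u → Tendsto (fun x : ℝ => L (u * x) / L x) atTop (𝓝 1))
    (hLbdd : ∀ b : ℝ, 0 < b → ∃ C : ℝ, ∀ x ∈ Set.Ioc (0 : ℝ) b, L x ≤ C) {δ : ℝ} (hδ : 0 < δ) :
    ∃ A X : ℝ, 0 < A ∧ 0 < X ∧ ∀ x l : ℝ, X ≤ x → 0 < l → L (x / l) / L x ≤ A * exp (δ * |log l|) := by
  obtain ⟨X₀, hX₀⟩ := potter_log (fun s => log (L (exp s))) (by fun_prop) (by
    intro u
    have h1 := (hLslow (exp u) (exp_pos u)).comp tendsto_exp_atTop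
    have h2 := h1.log one_ne_zero
    rw [log_one] at h2
    refine h2.congr (fun x => ?_)
    simp only [Function.comp]
    rw [← exp_add, add_comm u x, log_div (hLpos _ (exp_pos _)).ne' (hLpos _ (exp_pos _)).ne']) hδ
  have P : ∀ x y : ℝ, exp X₀ ≤ x → exp X₀ ≤ y → L y / L x ≤ exp (δ * (|log y - log x| + 1)) := by
    intro x y hx hy
    have hx0 := (exp_pos X₀).trans_le hx
    have hy0 := (exp_pos X₀).trans_le hy
    have := hX₀ (log x) (log y) ((le_log_iff_exp_le hx0).2 hx) ((le_log_iff_exp_le hy0).2 hy)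
    rw [exp_log hx0, exp_log hy0] at this
    have h2 := (le_abs_self _).trans this
    have h3 := exp_le_exp.2 h2
    rwa [exp_sub, exp_log (hLpos _ hx0), exp_log (hLpos _ hy0)] at h3
  have hXp := exp_pos X₀
  obtain ⟨C, hC⟩ := hLbdd (exp X₀) hXp
  have hLX := hLpos _ hXp
  have hCL : L (exp X₀) ≤ C := hC _ ⟨hXp, le_rfl⟩
  have hC1 : 1 ≤ C / L (exp X₀) := (one_le_div hLX).2 hCL
  refine ⟨C / L (exp X₀) * exp δ, exp X₀, by positivity, hXp, fun x l hx hl => ?_⟩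
  have hx0 := hXp.trans_le hx
  rcases le_or_gt (exp X₀) (x / l) with h | h
  · have h2 := P x (x / l) hx h
    rw [log_div hx0.ne' hl.ne', show log x - log l - log x = - log l by ring, abs_neg, mul_add, mul_one, exp_add] at h2
    refine h2.trans ?_
    have : 0 < exp (δ * |log l|) * exp δ := by positivity
    nlinarith
  · have h2 := P x (exp X₀) hx le_rfl
    have hlx : log (x / exp X₀) ≤ log l := by
      refine log_le_log (by positivity) ?_
      rw [div_le_iff₀ hXp]
      rw [div_lt_iff₀ hl] at h
      linarith
    have hlx0 : 0 ≤ log (x / exp X₀) := log_nonneg ((one_le_div hXp).2 hx)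
    have e : |log (exp X₀) - log x| ≤ |log l| := by
      rw [abs_sub_comm, ← log_div hx0.ne' hXp.ne', abs_of_nonneg hlx0]
      exact hlx.trans (le_abs_self _)
    have h3 : L (exp X₀) / L x ≤ exp (δ * |log l|) * exp δ := by
      rw [← exp_add]
      refine h2.trans (exp_le_exp.2 ?_)
      nlinarith
    have h4 : L (x / l) ≤ C := hC _ ⟨by positivity, h.le⟩
    have hLx := hLpos x hx0
    calc L (x / l) / L x ≤ C / L x := by gcongr
      _ = C / L (exp X₀) * (L (exp X₀) / L x) := by field_simp
      _ ≤ C / L (exp X₀) * (exp (δ * |log l|) * exp δ) := by gcongr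
      _ = _ := by ring

/-- For `β ∈ (0,1)`, `μ > 0`, `t > 0`, `κ₀ ∈ (0,1)`, `α > κ₀/2`, and a measurable
positive function `L` on `(0,∞)` that is slowly varying at infinity and bounded on every
finite interval,
`∫_0^∞ E_β²(−μλ^α t^β) λ^{κ₀−1} |1 − L(1/(λε))/L(1/ε)| dλ → 0` as `ε → 0⁺`. -/
theorem slowly_varying_integral_limit (β μ t κ₀ α : ℝ)
    (hβ : β ∈ Set.Ioo (0 : ℝ) 1) (hμ : 0 < μ) (ht : 0 < t)
    (hκ₀ : κ₀ ∈ Set.Ioo (0 : ℝ) 1) (hα : κ₀ / 2 < α)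
    (L : ℝ → ℝ) (hLmeas : Measurable L) (hLpos : ∀ x : ℝ, 0 < x → 0 < L x)
    (hLslow : ∀ u : ℝ, 0 < u →
      Filter.Tendsto (fun x : ℝ => L (u * x) / L x) Filter.atTop (𝓝 1))
    (hLbdd : ∀ b : ℝ, 0 < b → ∃ C : ℝ, ∀ x ∈ Set.Ioc (0 : ℝ) b, L x ≤ C) :
    Filter.Tendsto
      (fun ε : ℝ =>
        ∫ lam in Set.Ioi (0 : ℝ),
          (mittagLeffler β (-(μ * lam ^ α * t ^ β))) ^ 2 * lam ^ (κ₀ - 1) *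
            |1 - L (1 / (lam * ε)) / L (1 / ε)|)
      (𝓝[>] (0 : ℝ)) (𝓝 0) := by
  obtain ⟨h0, h1⟩ := hβ
  have hMLm : Measurable (mittagLeffler β) := (ml_continuous h0 h1).measurable
  obtain ⟨δ, hδ, hδ1, hδ2⟩ : ∃ δ : ℝ, 0 < δ ∧ δ < κ₀ ∧ δ < 2 * α - κ₀ := by
    obtain ⟨δ, ha, hb⟩ := exists_between (lt_min hκ₀.1 (by linarith : 0 < 2 * α - κ₀))
    exact ⟨δ, ha, hb.trans_le (min_le_left _ _), hb.trans_le (min_le_right _ _)⟩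
  obtain ⟨A, X, hA, hX, hP⟩ := potter L hLmeas hLpos hLslow hLbdd hδ
  obtain ⟨C, hC, hdec⟩ := ml_decay h0 h1
  have htb : 0 < t ^ β := Real.rpow_pos_of_pos ht _
  set c := μ * t ^ β with hc
  have hc0 : 0 < c := mul_pos hμ htb
  have hx : Tendsto (fun ε : ℝ => 1 / ε) (𝓝[>] 0) atTop := by
    simpa only [one_div] using tendsto_inv_nhdsGT_zero (𝕜 := ℝ)
  set K := (1 + A) * (1 + C ^ 2 / c ^ 2) with hK
  have hK0 : 0 < K := by positivity
  have hzero : (0:ℝ) = ∫ lam in Set.Ioi (0 : ℝ), (0:ℝ) := by simp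
  refine Eq.subst (motive := fun z => Tendsto _ _ (𝓝 z)) hzero.symm ?_
  refine tendsto_integral_filter_of_dominated_convergence
    (fun l => K * (if l ≤ 1 then l ^ (κ₀ - 1 - δ) else l ^ (κ₀ - 1 + δ - 2 * α))) ?_ ?_ ?_ ?_
  · exact Eventually.of_forall fun ε => Measurable.aestronglyMeasurable (by fun_prop)
  · filter_upwards [hx.eventually_ge_atTop X, self_mem_nhdsWithin] with ε hε hε0
    refine ae_restrict_of_forall_mem measurableSet_Ioi (fun l hl => ?_)
    have hl0 : 0 < l := hl
    have hε0' : 0 < ε := hε0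
    have hr := hP (1 / ε) l hε hl0
    rw [div_div, mul_comm ε l] at hr
    have hrpos : 0 < L (1 / (l * ε)) / L (1 / ε) :=
      div_pos (hLpos _ (by positivity)) (hLpos _ (by positivity))
    have hE1 : 1 ≤ exp (δ * |log l|) := one_le_exp (by positivity)
    have hab : |1 - L (1 / (l * ε)) / L (1 / ε)| ≤ (1 + A) * exp (δ * |log l|) := by
      rw [abs_le]; constructor <;> nlinarith
    have hla : 0 < l ^ α := Real.rpow_pos_of_pos hl0 _
    have harg : μ * l ^ α * t ^ β = c * l ^ α := by rw [hc]; ring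
    have hlk : 0 < l ^ (κ₀ - 1) := Real.rpow_pos_of_pos hl0 _
    rw [harg, norm_mul, norm_mul, Real.norm_eq_abs, Real.norm_eq_abs, Real.norm_eq_abs, abs_abs,
      abs_of_pos hlk, abs_of_nonneg (sq_nonneg _), ← sq_abs]
    have hm1 := ml_le_one h0 h1 (show 0 ≤ c * l ^ α by positivity)
    have hm2 := hdec (c * l ^ α) (by positivity)
    have hm0 := abs_nonneg (mittagLeffler β (-(c * l ^ α)))
    set m := |mittagLeffler β (-(c * l ^ α))| with hm
    split_ifs with hle
    · have hexp : exp (δ * |log l|) = l ^ (-δ) := by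
        rw [abs_of_nonpos (log_nonpos hl0.le hle), Real.rpow_def_of_pos hl0]; congr 1; ring
      rw [hexp] at hab
      have hsq : m ^ 2 ≤ 1 + C ^ 2 / c ^ 2 := by
        have : 0 ≤ C ^ 2 / c ^ 2 := by positivity
        nlinarith
      calc m ^ 2 * l ^ (κ₀ - 1) * |1 - L (1 / (l * ε)) / L (1 / ε)|
          ≤ (1 + C ^ 2 / c ^ 2) * l ^ (κ₀ - 1) * ((1 + A) * l ^ (-δ)) := by gcongr
        _ = K * (l ^ (κ₀ - 1) * l ^ (-δ)) := by rw [hK]; ring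
        _ = _ := by rw [← Real.rpow_add hl0, ← sub_eq_add_neg]
    · have hle' : 1 ≤ l := (not_le.1 hle).le
      have hexp : exp (δ * |log l|) = l ^ δ := by
        rw [abs_of_nonneg (log_nonneg hle'), Real.rpow_def_of_pos hl0]; congr 1; ring
      rw [hexp] at hab
      have hsq : m ^ 2 ≤ (1 + C ^ 2 / c ^ 2) * l ^ (-(2 * α)) := by
        have e : l ^ (-(2 * α)) = 1 / (l ^ α) ^ 2 := by
          rw [Real.rpow_neg hl0.le, one_div, ← Real.rpow_natCast, ← Real.rpow_mul hl0.le]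
          congr 2; push_cast; ring
        have h2 : m ≤ C / (c * l ^ α) := by
          rw [le_div_iff₀ (by positivity)]; linarith
        calc m ^ 2 ≤ (C / (c * l ^ α)) ^ 2 := by gcongr
          _ = C ^ 2 / c ^ 2 * (1 / (l ^ α) ^ 2) := by field_simp
          _ ≤ (1 + C ^ 2 / c ^ 2) * (1 / (l ^ α) ^ 2) := by gcongr; linarith
          _ = _ := by rw [e]
      calc m ^ 2 * l ^ (κ₀ - 1) * |1 - L (1 / (l * ε)) / L (1 / ε)|
          ≤ ((1 + C ^ 2 / c ^ 2) * l ^ (-(2 * α))) * l ^ (κ₀ - 1) * ((1 + A) * l ^ δ) := by gcongr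
        _ = K * (l ^ (κ₀ - 1) * l ^ δ * l ^ (-(2 * α))) := by rw [hK]; ring
        _ = _ := by rw [← Real.rpow_add hl0, ← Real.rpow_add hl0, ← sub_eq_add_neg]
  · refine Integrable.const_mul ?_ K
    change IntegrableOn _ (Set.Ioi (0:ℝ)) volume
    rw [← Set.Ioc_union_Ioi_eq_Ioi (zero_le_one (α := ℝ))]
    refine IntegrableOn.union ?_ ?_
    · have : IntegrableOn (fun l : ℝ => l ^ (κ₀ - 1 - δ)) (Set.Ioc 0 1) := by
        rw [integrableOn_Ioc_iff_integrableOn_Ioo,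
          intervalIntegral.integrableOn_Ioo_rpow_iff one_pos]
        linarith
      refine this.congr_fun (fun l hl => ?_) measurableSet_Ioc
      simp only [if_pos hl.2]
    · have : IntegrableOn (fun l : ℝ => l ^ (κ₀ - 1 + δ - 2 * α)) (Set.Ioi 1) :=
        integrableOn_Ioi_rpow_of_lt (by linarith) one_pos
      refine this.congr_fun (fun l hl => ?_) measurableSet_Ioi
      simp only [if_neg (not_le.2 (Set.mem_Ioi.1 hl))]
  · refine ae_restrict_of_forall_mem measurableSet_Ioi (fun l hl => ?_)
    have hl0 : 0 < l := hl
    have h2 := (hLslow (1 / l) (by positivity)).comp hx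
    have h3 := ((h2.const_sub 1).abs).const_mul
      ((mittagLeffler β (-(μ * l ^ α * t ^ β))) ^ 2 * l ^ (κ₀ - 1))
    simp only [sub_self, abs_zero, mul_zero] at h3
    refine h3.congr (fun ε => ?_)
    simp only [Function.comp]
    rw [show 1 / l * (1 / ε) = 1 / (l * ε) by rw [one_div_mul_one_div]]
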